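/- Let s = t_{i,i+1} be a simple transposition and y, w ∈ S_n with l(ys) < l(y), y ≤ w, and l(ws) < l(w). Then #R(ys,w) = #R(y,w) + 1; consequently #R(y,w) = l(w) − l(y) if and only if #R(ys,w) = l(w) − l(ys) (i.e., e_y is a smooth point of X_w if and only if e_{ys} is). -/

import Mathlib

open scoped Classical

namespace BSW

/-- The number of inversions (the length) of a permutation of `Fin n`. -/
def invLen {n : ℕ} (w : Equiv.Perm (Fin n)) : ℕ :=
  (Finset.univ.filter (fun p : Fin n × Fin n => p.1 < p.2 ∧ w p.2 < w p.1)).card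

/-- The rank function `r_w(p,q) = #{i : 1 ≤ i ≤ p and w(i) ≥ q}`, where the
permutation of `Fin n` is regarded as a permutation of `{1,…,n}` (so position
`i : Fin n` corresponds to `i+1` and value `w i` to `(w i)+1`). -/
def rank {n : ℕ} (w : Equiv.Perm (Fin n)) (p q : ℤ) : ℕ :=
  (Finset.univ.filter (fun i : Fin n =>
    ((i : ℕ) : ℤ) + 1 ≤ p ∧ q ≤ ((w i : ℕ) : ℤ) + 1)).card

/-- The difference function `d_{x,w}(p,q) = r_w(p,q) − r_x(p,q)`. -/
def dxw {n : ℕ} (x w : Equiv.Perm (Fin n)) (p q : ℤ) : ℤ :=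
  (rank w p q : ℤ) - (rank x p q : ℤ)

/-- The Bruhat order: `x ≤ w` iff `d_{x,w}` is everywhere non-negative. -/
def bruhatLE {n : ℕ} (x w : Equiv.Perm (Fin n)) : Prop :=
  ∀ p q : ℤ, 0 ≤ dxw x w p q

/-- The set of transpositions in `S_n`. -/
def transpositions (n : ℕ) : Set (Equiv.Perm (Fin n)) :=
  {t | ∃ a b : Fin n, a ≠ b ∧ t = Equiv.swap a b}

/-- `R(x,w) = {t ∈ T : l(xt) > l(x) and xt ≤ w}`. -/
def R {n : ℕ} (x w : Equiv.Perm (Fin n)) : Set (Equiv.Perm (Fin n)) :=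
  {t | t ∈ transpositions n ∧ invLen x < invLen (x * t) ∧ bruhatLE (x * t) w}

/-- `x` is a maximal singular point (MSP) for `w`. -/
def MSP {n : ℕ} (x w : Equiv.Perm (Fin n)) : Prop :=
  bruhatLE x w ∧ ((invLen w : ℤ) - (invLen x : ℤ) < ((R x w).ncard : ℤ)) ∧
    ∀ t ∈ R x w, ((R (x * t) w).ncard : ℤ) = (invLen w : ℤ) - (invLen (x * t) : ℤ)

/-- `Δ(x,w) = {i : t_{{i,j}} ∈ R(x,w) for some j}`. -/
def Delta {n : ℕ} (x w : Equiv.Perm (Fin n)) : Set (Fin n) :=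
  {i | ∃ j : Fin n, Equiv.swap i j ∈ R x w}

/-- `Δ(x,w)` as a finset. -/
noncomputable def DeltaFinset {n : ℕ} (x w : Equiv.Perm (Fin n)) : Finset (Fin n) :=
  (Set.toFinite (Delta x w)).toFinset

/-- `σ ∈ S_k` is the flattening of `x` along the increasing enumeration `d_1 < … < d_k`
of a set `D` of positions with `#D = k`: the unique permutation of `{1,…,k}` with
`σ(a) < σ(b)` iff `x(d_a) < x(d_b)`. -/
def IsFlatteningOn {n k : ℕ} (x : Equiv.Perm (Fin n)) (D : Finset (Fin n))
    (hD : D.card = k) (σ : Equiv.Perm (Fin k)) : Prop :=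
  ∀ a b : Fin k, σ a < σ b ↔ x ((D.orderIsoOfFin hD a : Fin n)) < x ((D.orderIsoOfFin hD b : Fin n))

/-- Values (0-indexed) of the permutation `x_{k,m} = [k,…,1, k+m,…,k+1]`. -/
def xkmVal (k m i : ℕ) : ℕ :=
  if i < k then k - 1 - i else 2 * k + m - 1 - i

/-- Values (0-indexed) of the permutation `w_{k,m} = [k+m, k,…,2, k+m−1,…,k+1, 1]`. -/
def wkmVal (k m i : ℕ) : ℕ :=
  if i = 0 then k + m - 1
  else if i < k then k - i
  else if i < k + m - 1 then 2 * k + m - 2 - i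
  else 0

/-- Values (0-indexed) of the permutation `x_{k,l,m} = [k,…,1, k+l,…,k+1, k+l+m,…,k+l+1]`. -/
def xklmVal (k l m i : ℕ) : ℕ :=
  if i < k then k - 1 - i
  else if i < k + l then 2 * k + l - 1 - i
  else 2 * (k + l) + m - 1 - i

/-- Values (0-indexed) of the permutation
`w_{k,l,m} = [k+l, k,…,2, k+l+m, k+l−1,…,k+2, 1, k+l+m−1,…,k+l+1, k+1]`. -/
def wklmVal (k l m i : ℕ) : ℕ :=
  if i = 0 then k + l - 1
  else if i < k then k - i
  else if i = k then k + l + m - 1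
  else if i < k + l - 1 then 2 * k + l - 1 - i
  else if i = k + l - 1 then 0
  else if i < k + l + m - 1 then 2 * (k + l) + m - 2 - i
  else k

theorem invLen_lt_mul_swap {n : ℕ} (x : Equiv.Perm (Fin n)) {i j : Fin n}
    (hij : i < j) (hx : x i < x j) : invLen x < invLen (x * Equiv.swap i j) := by
  set t := Equiv.swap i j with ht
  have htt : ∀ k, t (t k) = k := fun k => Equiv.swap_apply_self i j k
  have htval : ∀ k, t k = if k = i then j else if k = j then i else k :=
    fun k => Equiv.swap_apply_def i j k
  set f : Fin n × Fin n → Fin n × Fin n :=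
    fun p => if t p.1 < t p.2 then (t p.1, t p.2) else p with hf
  set S := Finset.univ.filter (fun p : Fin n × Fin n => p.1 < p.2 ∧ x p.2 < x p.1) with hS
  set S' := Finset.univ.filter
    (fun p : Fin n × Fin n => p.1 < p.2 ∧ (x * t) p.2 < (x * t) p.1) with hS'
  have hinj : Set.InjOn f (S : Set (Fin n × Fin n)) := by
    rintro ⟨p, q⟩ hp ⟨p', q'⟩ hp' h
    simp only [hS, Finset.coe_filter, Finset.mem_univ, true_and, Set.mem_ofPred_eq] at hp hp'
    simp only [hf] at h
    have h1 := htt p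
    have h2 := htt q
    have h3 := htt p'
    have h4 := htt q'
    split_ifs at h <;> simp only [Prod.mk.injEq] at h ⊢ <;> grind
  have hsub : S.image f ⊂ S' := by
    refine (Finset.ssubset_iff_of_subset ?_).2 ⟨(i, j), ?_, ?_⟩
    · intro u hu
      obtain ⟨⟨p, q⟩, hp, rfl⟩ := Finset.mem_image.1 hu
      simp only [hS, Finset.mem_filter, Finset.mem_univ, true_and] at hp
      simp only [hS', hf, Finset.mem_filter, Finset.mem_univ, true_and]
      simp only [Equiv.Perm.mul_apply]
      split_ifs with h
      · exact ⟨h, by simpa only [htt] using hp.2⟩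
      · refine ⟨hp.1, ?_⟩
        have h1 := htval p
        have h2 := htval q
        grind
    · simp only [hS', Finset.mem_filter, Finset.mem_univ, true_and, Equiv.Perm.mul_apply, ht,
        Equiv.swap_apply_left, Equiv.swap_apply_right]
      exact ⟨hij, hx⟩
    · intro hu
      obtain ⟨⟨p, q⟩, hp, he⟩ := Finset.mem_image.1 hu
      simp only [hS, Finset.mem_filter, Finset.mem_univ, true_and] at hp
      simp only [hf] at he
      have h1 := htval p
      have h2 := htval q
      split_ifs at he <;> simp only [Prod.mk.injEq] at he <;> grind
  calc invLen x = (S.image f).card := (Finset.card_image_of_injOn hinj).symm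
    _ < S'.card := Finset.card_lt_card hsub
    _ = invLen (x * t) := rfl

theorem invLen_lt_mul_swap_iff {n : ℕ} (x : Equiv.Perm (Fin n)) {i j : Fin n} (hij : i < j) :
    invLen x < invLen (x * Equiv.swap i j) ↔ x i < x j := by
  refine ⟨fun h => ?_, invLen_lt_mul_swap x hij⟩
  by_contra hx
  have hx' : x j < x i := lt_of_le_of_ne (not_lt.1 hx) fun he => hij.ne' (x.injective he)
  have := invLen_lt_mul_swap (x * Equiv.swap i j) hij (by simpa using hx')
  rw [mul_assoc, Equiv.swap_mul_self, mul_one] at this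
  exact lt_asymm h this

theorem apply_lt_apply_of_invLen_mul_swap_lt {n : ℕ} (x : Equiv.Perm (Fin n)) {i j : Fin n}
    (hij : i < j) (h : invLen (x * Equiv.swap i j) < invLen x) : x j < x i := by
  refine lt_of_le_of_ne (not_lt.1 fun hx => ?_) fun he => hij.ne' (x.injective he)
  exact lt_asymm h (invLen_lt_mul_swap x hij hx)

theorem swap_lt_swap_of_lt {n : ℕ} {a b : Fin n} (hab : (b : ℕ) = (a : ℕ) + 1) {i j : Fin n}
    (hij : i < j) (hne : ¬ (i = a ∧ j = b)) : Equiv.swap a b i < Equiv.swap a b j := by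
  rw [Equiv.swap_apply_def, Equiv.swap_apply_def]
  simp only [Fin.ext_iff, Fin.lt_def] at *
  split_ifs <;> omega

theorem invLen_le_invLen_mul_swap_add_one {n : ℕ} (x : Equiv.Perm (Fin n)) {a b : Fin n}
    (hab : (b : ℕ) = (a : ℕ) + 1) : invLen x ≤ invLen (x * Equiv.swap a b) + 1 := by
  set s := Equiv.swap a b with hs
  have hss : ∀ k, s (s k) = k := fun k => Equiv.swap_apply_self a b k
  set S := Finset.univ.filter (fun p : Fin n × Fin n => p.1 < p.2 ∧ x p.2 < x p.1) with hS
  have h : (S.erase (a, b)).card ≤ invLen (x * s) := by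
    refine Finset.card_le_card_of_injOn (fun p => (s p.1, s p.2)) ?_ ?_
    · rintro ⟨p, q⟩ hp
      simp only [hS, Finset.coe_erase, Finset.coe_filter, Finset.mem_univ, true_and,
        Set.mem_sdiff, Set.mem_ofPred_eq, Set.mem_singleton_iff, Prod.mk.injEq] at hp
      simp only [Finset.coe_filter, Finset.mem_univ, true_and, Set.mem_ofPred_eq]
      simp only [Equiv.Perm.mul_apply, hss]
      exact ⟨swap_lt_swap_of_lt hab hp.1.1 hp.2, hp.1.2⟩
    · rintro ⟨p, q⟩ - ⟨p', q'⟩ - he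
      simpa using he
  calc invLen x = S.card := rfl
    _ ≤ (S.erase (a, b)).card + 1 := by have := Finset.pred_card_le_card_erase (s := S) (a := (a, b)); omega
    _ ≤ _ := Nat.add_le_add_right h 1

theorem rank_mul_swap {n : ℕ} (x : Equiv.Perm (Fin n)) {a b : Fin n}
    (hab : (b : ℕ) = (a : ℕ) + 1) (p q : ℤ) (hp : p ≠ (a : ℕ) + 1) :
    rank (x * Equiv.swap a b) p q = rank x p q := by
  have hle : ∀ i : Fin n,
      ((i : ℕ) : ℤ) + 1 ≤ p ↔ ((Equiv.swap a b i : Fin n) : ℤ) + 1 ≤ p := by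
    intro i
    rw [Equiv.swap_apply_def]
    split_ifs with h1 h2
    · subst h1; omega
    · subst h2; omega
    · rfl
  refine Finset.card_bij (fun i _ => Equiv.swap a b i) ?_ ?_ ?_
  · intro i hi
    simp only [Finset.mem_filter, Finset.mem_univ, true_and] at hi ⊢
    exact ⟨(hle i).1 hi.1, hi.2⟩
  · intro i _ j _ h
    exact (Equiv.swap a b).injective h
  · intro i hi
    refine ⟨Equiv.swap a b i, ?_, Equiv.swap_apply_self a b i⟩
    simp only [Finset.mem_filter, Finset.mem_univ, true_and] at hi ⊢
    exact ⟨(hle i).1 hi.1, by simpa using hi.2⟩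

theorem rank_succ {n : ℕ} (x : Equiv.Perm (Fin n)) (a : Fin n) (q : ℤ) :
    rank x ((a : ℕ) + 1) q =
      rank x (a : ℕ) q + if q ≤ ((x a : ℕ) : ℤ) + 1 then 1 else 0 := by
  unfold rank
  split_ifs with h
  · rw [← Finset.card_insert_of_notMem (a := a) (by simp)]
    congr 1
    ext i
    simp only [Finset.mem_filter, Finset.mem_univ, true_and, Finset.mem_insert]
    by_cases hi : i = a
    · subst hi; simp [h]
    · have : (i : ℕ) ≠ a := fun e => hi (Fin.ext e)
      simp only [hi, false_or]
      refine and_congr_left fun _ => ?_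
      omega
  · rw [add_zero]
    congr 1
    ext i
    simp only [Finset.mem_filter, Finset.mem_univ, true_and]
    refine and_congr_left fun hq => ?_
    have : (i : ℕ) ≠ a := fun e => h (Fin.ext e ▸ hq)
    omega

theorem bruhatLE_mul_swap {n : ℕ} {z w : Equiv.Perm (Fin n)} {a b : Fin n}
    (hab : (b : ℕ) = (a : ℕ) + 1) (hw : w b < w a) (hz : bruhatLE z w) :
    bruhatLE (z * Equiv.swap a b) w := by
  have hz' : ∀ p q, rank z p q ≤ rank w p q := fun p q => by
    have := hz p q
    unfold dxw at this
    omega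
  suffices h : ∀ p q, rank (z * Equiv.swap a b) p q ≤ rank w p q from fun p q => by
    have := h p q
    unfold dxw
    omega
  intro p q
  by_cases hp : p = (a : ℕ) + 1
  · subst hp
    have h1 := rank_succ (z * Equiv.swap a b) a q
    have h2 := rank_succ w a q
    have h3 := rank_succ (z * Equiv.swap a b) b q
    have h4 := rank_succ w b q
    have h5 := rank_mul_swap z hab (a : ℕ) q (by omega)
    have h6 := rank_mul_swap z hab ((b : ℕ) + 1) q (by omega)
    have h7 := hz' (a : ℕ) q
    have h8 := hz' ((b : ℕ) + 1) q
    rw [Fin.lt_def] at hw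
    have hab' : ((b : ℕ) : ℤ) = (a : ℕ) + 1 := by exact_mod_cast hab
    rw [hab'] at h3 h4 h6 h8
    split_ifs at h1 h2 h3 h4 <;> omega
  · rw [rank_mul_swap z hab p q hp]
    exact hz' p q

theorem bruhatLE_mul_swap_iff {n : ℕ} {z w : Equiv.Perm (Fin n)} {a b : Fin n}
    (hab : (b : ℕ) = (a : ℕ) + 1) (hw : w b < w a) :
    bruhatLE (z * Equiv.swap a b) w ↔ bruhatLE z w := by
  refine ⟨fun h => ?_, bruhatLE_mul_swap hab hw⟩
  simpa [mul_assoc] using bruhatLE_mul_swap hab hw h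

theorem mem_R_iff {n : ℕ} {x w t : Equiv.Perm (Fin n)} :
    t ∈ R x w ↔ ∃ i j, i < j ∧ t = Equiv.swap i j ∧ x i < x j ∧ bruhatLE (x * t) w := by
  constructor
  · rintro ⟨⟨i, j, hij, rfl⟩, hl, hb⟩
    rcases hij.lt_or_gt with h | h
    · exact ⟨i, j, h, rfl, (invLen_lt_mul_swap_iff x h).1 hl, hb⟩
    · rw [Equiv.swap_comm] at hl hb ⊢
      exact ⟨j, i, h, rfl, (invLen_lt_mul_swap_iff x h).1 hl, hb⟩
  · rintro ⟨i, j, hij, rfl, hx, hb⟩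
    exact ⟨⟨i, j, hij.ne, rfl⟩, invLen_lt_mul_swap x hij hx, hb⟩

theorem conj_mem_R {n : ℕ} {x w t : Equiv.Perm (Fin n)} {a b : Fin n}
    (hab : (b : ℕ) = (a : ℕ) + 1) (hw : w b < w a) (hne : t ≠ Equiv.swap a b)
    (ht : t ∈ R x w) :
    Equiv.swap a b * t * Equiv.swap a b ∈ R (x * Equiv.swap a b) w := by
  obtain ⟨i, j, hij, rfl, hx, hb⟩ := mem_R_iff.1 ht
  refine mem_R_iff.2 ⟨Equiv.swap a b i, Equiv.swap a b j,
    swap_lt_swap_of_lt hab hij (by rintro ⟨rfl, rfl⟩; exact hne rfl), ?_, by simpa using hx, ?_⟩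
  · have := Equiv.swap_apply_apply (Equiv.swap a b) i j
    rw [Equiv.swap_inv] at this
    exact this.symm
  · have : x * Equiv.swap a b * (Equiv.swap a b * Equiv.swap i j * Equiv.swap a b) =
        x * Equiv.swap i j * Equiv.swap a b := by
      simp [mul_assoc]
    rw [this]
    exact bruhatLE_mul_swap hab hw hb

theorem R_mul_swap_eq_insert {n : ℕ} {y w : Equiv.Perm (Fin n)} {a b : Fin n}
    (hab : (b : ℕ) = (a : ℕ) + 1) (hy : y b < y a) (hyw : bruhatLE y w) (hw : w b < w a) :
    R (y * Equiv.swap a b) w =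
      insert (Equiv.swap a b) ((fun t => Equiv.swap a b * t * Equiv.swap a b) '' R y w) := by
  have hlt : a < b := by rw [Fin.lt_def]; omega
  ext t
  simp only [Set.mem_insert_iff, Set.mem_image]
  constructor
  · intro ht
    by_cases hts : t = Equiv.swap a b
    · exact Or.inl hts
    · refine Or.inr ⟨Equiv.swap a b * t * Equiv.swap a b, ?_, by simp [mul_assoc]⟩
      simpa [mul_assoc] using conj_mem_R hab hw hts ht
  · rintro (rfl | ⟨t, ht, rfl⟩)
    · exact mem_R_iff.2 ⟨a, b, hlt, rfl, by simpa using hy, by simpa [mul_assoc] using hyw⟩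
    · refine conj_mem_R hab hw ?_ ht
      rintro rfl
      exact lt_asymm hy ((invLen_lt_mul_swap_iff y hlt).1 ht.2.1)

theorem ncard_R_mul_swap {n : ℕ} {y w : Equiv.Perm (Fin n)} {a b : Fin n}
    (hab : (b : ℕ) = (a : ℕ) + 1) (hy : y b < y a) (hyw : bruhatLE y w) (hw : w b < w a) :
    (R (y * Equiv.swap a b) w).ncard = (R y w).ncard + 1 := by
  have hlt : a < b := by rw [Fin.lt_def]; omega
  rw [R_mul_swap_eq_insert hab hy hyw hw, Set.ncard_insert_of_notMem _ (Set.toFinite _),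
    Set.ncard_image_of_injective]
  · intro t t' h
    simpa using h
  · rintro ⟨t, ht, he⟩
    have hts : t = Equiv.swap a b := by
      have := congrArg (fun u => Equiv.swap a b * u * Equiv.swap a b) he
      simpa [mul_assoc] using this
    rw [hts] at ht
    exact lt_asymm hy ((invLen_lt_mul_swap_iff y hlt).1 ht.2.1)

/-- If `s = t_{i,i+1}` is a simple transposition with `l(ys) < l(y)`, `y ≤ w` and
`l(ws) < l(w)`, then `#R(ys,w) = #R(y,w) + 1`; consequently `#R(y,w) = l(w) − l(y)`
iff `#R(ys,w) = l(w) − l(ys)` (i.e. `e_y` is smooth in `X_w` iff `e_{ys}` is). -/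
theorem card_R_mul_simple {n : ℕ} (y w : Equiv.Perm (Fin n)) (a b : Fin n)
    (hab : (b : ℕ) = (a : ℕ) + 1)
    (hys : invLen (y * Equiv.swap a b) < invLen y)
    (hyw : bruhatLE y w)
    (hws : invLen (w * Equiv.swap a b) < invLen w) :
    (R (y * Equiv.swap a b) w).ncard = (R y w).ncard + 1 ∧
      (((R y w).ncard : ℤ) = (invLen w : ℤ) - (invLen y : ℤ) ↔
        ((R (y * Equiv.swap a b) w).ncard : ℤ) =
          (invLen w : ℤ) - (invLen (y * Equiv.swap a b) : ℤ)) := by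
  have hlt : a < b := by rw [Fin.lt_def]; omega
  have hcard := ncard_R_mul_swap hab (apply_lt_apply_of_invLen_mul_swap_lt y hlt hys) hyw
    (apply_lt_apply_of_invLen_mul_swap_lt w hlt hws)
  have hlen := invLen_le_invLen_mul_swap_add_one y hab
  exact ⟨hcard, by omega⟩

end BSW
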